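/- arXiv:1907.12948 — 2 statements merged into one kernel-verified Lean document; each statement's English description precedes it below -/
import Mathlib

section
/- Let A = (α_{ij}) be a reduced n×n matrix over 𝔼 whose determinant Δ = det(A) is zeroless. Then for every column index j ∈ {1,…,n} there exists i ∈ {1,…,n} such that the minor Δ_{i,j} is not contained in ⊘·Δ (in the paper's notation, |Δ_{i,j}| > ⊘Δ). -/
open scoped Pointwise Classical

noncomputable section

-- Note: `ℝ*` is Mathlib's notation for the hyperreals `Hyperreal`.

/-- A neutrix: an order-convex additive subgroup of the hyperreals. -/
def IsNeutrix (A : Set ℝ*) : Prop :=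
  (0 : ℝ*) ∈ A ∧ (∀ x ∈ A, ∀ y ∈ A, x + y ∈ A) ∧ (∀ x ∈ A, -x ∈ A) ∧
    ∀ x ∈ A, ∀ y ∈ A, ∀ z : ℝ*, x ≤ z → z ≤ y → z ∈ A

/-- The coset `a + A`. -/
def coset (a : ℝ*) (A : Set ℝ*) : Set ℝ* := {x | ∃ u ∈ A, x = a + u}

/-- `α` is an external number: a coset of a neutrix. -/
def IsExt (α : Set ℝ*) : Prop := ∃ a A, IsNeutrix A ∧ α = coset a A

/-- The neutrix part `N(α)` of an external number, as the set of differences. -/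
def Nx (α : Set ℝ*) : Set ℝ* := {d | ∃ x ∈ α, ∃ y ∈ α, d = x - y}

/-- An external number is zeroless if it does not contain `0`. -/
def Zeroless (α : Set ℝ*) : Prop := (0 : ℝ*) ∉ α

/-- Multiplication of external numbers: `αβ = ab + aB + bA + AB`
(independent of the chosen representatives). -/
def emul (α β : Set ℝ*) : Set ℝ* :=
  {z | ∃ a A b B, IsNeutrix A ∧ IsNeutrix B ∧ α = coset a A ∧ β = coset b B ∧
      ∃ u ∈ A, ∃ v ∈ B, ∃ u' ∈ A, ∃ v' ∈ B, z = a * b + a * v + b * u + u' * v'}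

/-- Multiplication of an external number by a hyperreal scalar: `t·α = ta + tA`. -/
def esmul (t : ℝ*) (α : Set ℝ*) : Set ℝ* := (fun x => t * x) '' α

/-- Inverse of a (zeroless) external number: `1/α = 1/a + A/a²`. -/
def einv (α : Set ℝ*) : Set ℝ* :=
  {z | ∃ a A, IsNeutrix A ∧ α = coset a A ∧ ∃ u ∈ A, z = a⁻¹ + u / a ^ 2}

/-- Division of external numbers: `α/β = α · (1/β)`. -/
def ediv (α β : Set ℝ*) : Set ℝ* := emul α (einv β)

/-- The neutrix `⊘` of infinitesimal hyperreals. -/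
def oslash : Set ℝ* := {x | Hyperreal.Infinitesimal x}

/-- Relative uncertainty `R(α)`: `A/a` if `α = a + A` is zeroless,
and all of `ℝ*` if `α` is a neutrix. -/
def RU (α : Set ℝ*) : Set ℝ* :=
  if (0 : ℝ*) ∈ α then Set.univ
  else {z | ∃ a A, IsNeutrix A ∧ α = coset a A ∧ ∃ u ∈ A, z = u / a}

/-- `α` and `β` are nearly opposite: both zeroless and `α/β ⊆ -1 + ⊘`. -/
def NearlyOpposite (α β : Set ℝ*) : Prop :=
  Zeroless α ∧ Zeroless β ∧ ediv α β ⊆ coset (-1) oslash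

/-- Order on external numbers: `α ≤ β` iff `∀ x ∈ α, ∃ y ∈ β, x ≤ y`. -/
def ele (α β : Set ℝ*) : Prop := ∀ x ∈ α, ∃ y ∈ β, x ≤ y

/-- `α` is non-negative: some element of `α` is `≥ 0`. -/
def eNonneg (α : Set ℝ*) : Prop := ∃ x ∈ α, (0 : ℝ*) ≤ x

/-- Absolute value of an external number: `|α| = |a| + A`. -/
def eabs (α : Set ℝ*) : Set ℝ* :=
  {z | ∃ a A, IsNeutrix A ∧ α = coset a A ∧ ∃ u ∈ A, z = |a| + u}

/-- Product of a finite family of external numbers. -/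
def eprod : ∀ {n : ℕ}, (Fin n → Set ℝ*) → Set ℝ*
  | 0, _ => {1}
  | _ + 1, f => emul (f 0) (eprod fun i => f i.succ)

/-- Power of an external number. -/
def epow (α : Set ℝ*) : ℕ → Set ℝ*
  | 0 => {1}
  | k + 1 => emul α (epow α k)

/-- Matrix product over external numbers: `(AB)_{ij} = Σ_k α_{ik}β_{kj}`. -/
def matMul {m n p : ℕ} (M : Matrix (Fin m) (Fin n) (Set ℝ*))
    (N : Matrix (Fin n) (Fin p) (Set ℝ*)) : Matrix (Fin m) (Fin p) (Set ℝ*) :=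
  fun i j => ∑ k, emul (M i k) (N k j)

/-- Entrywise (Minkowski) sum of matrices over external numbers. -/
def matAdd {m n : ℕ} (M N : Matrix (Fin m) (Fin n) (Set ℝ*)) :
    Matrix (Fin m) (Fin n) (Set ℝ*) := fun i j => M i j + N i j

/-- Entrywise scalar multiple of a matrix by an external number. -/
def matSmul {m n : ℕ} (α : Set ℝ*) (M : Matrix (Fin m) (Fin n) (Set ℝ*)) :
    Matrix (Fin m) (Fin n) (Set ℝ*) := fun i j => emul α (M i j)

/-- Entrywise inclusion of matrices over external numbers. -/
def matIncl {m n : ℕ} (M N : Matrix (Fin m) (Fin n) (Set ℝ*)) : Prop :=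
  ∀ i j, M i j ⊆ N i j

/-- Determinant of a square matrix over the external numbers. -/
def detE {n : ℕ} (M : Matrix (Fin n) (Fin n) (Set ℝ*)) : Set ℝ* :=
  ∑ σ : Equiv.Perm (Fin n),
    esmul ((Equiv.Perm.sign σ : ℤ) : ℝ*) (eprod fun i => M i (σ i))

/-- The `(i,j)` minor of a square matrix over the external numbers. -/
def minorE {n : ℕ} (M : Matrix (Fin (n + 1)) (Fin (n + 1)) (Set ℝ*))
    (i j : Fin (n + 1)) : Set ℝ* :=
  detE (M.submatrix i.succAbove j.succAbove)

/-- The near-identity matrix `I_n(N)`: diagonal entries `1 + N`, off-diagonal entries `N`. -/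
def Iun (n : ℕ) (N : Set ℝ*) : Matrix (Fin n) (Fin n) (Set ℝ*) :=
  fun i j => if i = j then coset 1 N else N

/-- A finite family of vectors of external numbers is linearly dependent:
some nontrivial real (hyperreal) linear combination is a neutrix vector. -/
def LinDepE {ι : Type*} [Fintype ι] {n : ℕ} (ξ : ι → Fin n → Set ℝ*) : Prop :=
  ∃ t : ι → ℝ*, (∃ i, t i ≠ 0) ∧ ∃ A : Fin n → Set ℝ*,
    (∀ j, IsNeutrix (A j)) ∧ ∀ j, (∑ i, esmul (t i) (ξ i j)) = A j

/-- The matrix has a zeroless minor of order `k`. -/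
def HasZerolessMinor {m n : ℕ} (M : Matrix (Fin m) (Fin n) (Set ℝ*)) (k : ℕ) : Prop :=
  ∃ (f : Fin k → Fin m) (g : Fin k → Fin n), Function.Injective f ∧ Function.Injective g ∧
    Zeroless (detE fun i j => M (f i) (g j))

/-- The minor rank of `M` is `r`. -/
def minorRankIs {m n : ℕ} (M : Matrix (Fin m) (Fin n) (Set ℝ*)) (r : ℕ) : Prop :=
  HasZerolessMinor M r ∧ ∀ k, HasZerolessMinor M k → k ≤ r

/-- The row rank of `M` is `r`: the maximal cardinality of a linearly
independent set of row vectors of `M` is `r`. -/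
def rowRankIs {m n : ℕ} (M : Matrix (Fin m) (Fin n) (Set ℝ*)) (r : ℕ) : Prop :=
  (∃ s : Finset (Fin m), s.card = r ∧ ¬ LinDepE fun (i : {x // x ∈ s}) j => M i.1 j) ∧
  ∀ s : Finset (Fin m), (¬ LinDepE fun (i : {x // x ∈ s}) j => M i.1 j) → s.card ≤ r

/-- `M` is a reduced matrix: `max_{i,j} |α_{ij}| = 1 + A₀` for some neutrix `A₀ ⊆ ⊘`. -/
def IsReducedMat {m n : ℕ} (M : Matrix (Fin m) (Fin n) (Set ℝ*)) : Prop :=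
  ∃ A₀, IsNeutrix A₀ ∧ A₀ ⊆ oslash ∧ (∃ i j, eabs (M i j) = coset 1 A₀) ∧
    ∀ i j, ele (eabs (M i j)) (coset 1 A₀)

theorem IsNeutrix.mul_mem {A : Set ℝ*} (hA : IsNeutrix A) {t x : ℝ*} (hx : x ∈ A)
    (ht : |t| ≤ 1) : t * x ∈ A := by
  obtain ⟨-, -, hneg, hconv⟩ := hA
  have h : |t * x| ≤ |x| := by
    rw [abs_mul]; exact mul_le_of_le_one_left (abs_nonneg x) ht
  rcases abs_cases x with ⟨hx', -⟩ | ⟨hx', -⟩ <;> rw [hx', abs_le] at h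
  · exact hconv _ (hneg x hx) _ hx _ h.1 h.2
  · exact hconv _ hx _ (hneg x hx) _ (by linarith [h.1]) h.2

theorem IsNeutrix.mem_of_abs_le {A : Set ℝ*} (hA : IsNeutrix A) {x y : ℝ*} (hy : y ∈ A)
    (h : |x| ≤ |y|) : x ∈ A := by
  rcases eq_or_ne y 0 with rfl | hy0
  · have : x = 0 := by simpa using h
    rwa [this]
  · have : |x / y| ≤ 1 := by
      rw [abs_div]; exact div_le_one_of_le₀ h (abs_nonneg y)
    simpa [div_mul_cancel₀ _ hy0] using hA.mul_mem hy this

theorem isNeutrix_of_mul_mem {A : Set ℝ*} (h0 : (0 : ℝ*) ∈ A)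
    (hadd : ∀ x ∈ A, ∀ y ∈ A, x + y ∈ A) (hmul : ∀ t x : ℝ*, |t| ≤ 1 → x ∈ A → t * x ∈ A) :
    IsNeutrix A := by
  have key : ∀ x ∈ A, ∀ z : ℝ*, |z| ≤ |x| → z ∈ A := by
    intro x hx z hz
    rcases eq_or_ne x 0 with rfl | hx0
    · have : z = 0 := by simpa using hz
      rwa [this]
    · have : |z / x| ≤ 1 := by
        rw [abs_div]; exact div_le_one_of_le₀ hz (abs_nonneg x)
      simpa [div_mul_cancel₀ _ hx0] using hmul _ _ this hx
  refine ⟨h0, hadd, fun x hx => key x hx _ (abs_neg x).le, fun x hx y hy z hxz hzy => ?_⟩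
  rcases le_total 0 z with hz | hz
  · exact key y hy z (by rw [abs_of_nonneg hz]; exact hzy.trans (le_abs_self y))
  · exact key x hx z (by rw [abs_of_nonpos hz]; exact (neg_le_neg hxz).trans (neg_le_abs x))

theorem IsNeutrix.exists_mul_eq_add {A B : Set ℝ*} (hA : IsNeutrix A) (hB : IsNeutrix B)
    {u₁ u₂ v₁ v₂ : ℝ*} (hu₁ : u₁ ∈ A) (hu₂ : u₂ ∈ A) (hv₁ : v₁ ∈ B) (hv₂ : v₂ ∈ B) :
    ∃ u ∈ A, ∃ v ∈ B, u₁ * v₁ + u₂ * v₂ = u * v := by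
  obtain ⟨U, hU, hU₁, hU₂⟩ : ∃ U ∈ A, |u₁| ≤ |U| ∧ |u₂| ≤ |U| := by
    rcases le_total |u₁| |u₂| with h | h
    · exact ⟨u₂, hu₂, h, le_rfl⟩
    · exact ⟨u₁, hu₁, le_rfl, h⟩
  rcases eq_or_ne U 0 with rfl | hU0
  · have h₁ : u₁ = 0 := by simpa using hU₁
    have h₂ : u₂ = 0 := by simpa using hU₂
    exact ⟨0, hA.1, 0, hB.1, by simp [h₁, h₂]⟩
  · refine ⟨U, hU, u₁ / U * v₁ + u₂ / U * v₂,
      hB.2.1 _ (hB.mul_mem hv₁ ?_) _ (hB.mul_mem hv₂ ?_), by field_simp⟩ <;>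
    · rw [abs_div]; exact div_le_one_of_le₀ ‹_› (abs_nonneg U)

theorem mem_coset_self {A : Set ℝ*} (hA : IsNeutrix A) (a : ℝ*) : a ∈ coset a A :=
  ⟨0, hA.1, by simp⟩

theorem coset_eq_of_mem {A : Set ℝ*} (hA : IsNeutrix A) {a x : ℝ*} (hx : x ∈ coset a A) :
    coset a A = coset x A := by
  obtain ⟨w, hw, rfl⟩ := hx
  ext y
  constructor
  · rintro ⟨u, hu, rfl⟩
    exact ⟨u + -w, hA.2.1 _ hu _ (hA.2.2.1 _ hw), by ring⟩
  · rintro ⟨u, hu, rfl⟩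
    exact ⟨w + u, hA.2.1 _ hw _ hu, by ring⟩

theorem IsExt.eq_coset {α : Set ℝ*} (hα : IsExt α) {x : ℝ*} (hx : x ∈ α) :
    ∃ A, IsNeutrix A ∧ α = coset x A := by
  obtain ⟨a, A, hA, rfl⟩ := hα
  exact ⟨A, hA, coset_eq_of_mem hA hx⟩

theorem coset_subset_of_eq {a a' : ℝ*} {A A' : Set ℝ*} (hA : IsNeutrix A) (hA' : IsNeutrix A')
    (h : coset a A = coset a' A') : A' ⊆ A := by
  intro u hu
  obtain ⟨w, hw, hw'⟩ : a' ∈ coset a A := h ▸ mem_coset_self hA' a'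
  obtain ⟨y, hy, hy'⟩ : a' + u ∈ coset a A := h ▸ ⟨u, hu, rfl⟩
  have : u = y + -w := by linear_combination hy' - hw'
  rw [this]
  exact hA.2.1 _ hy _ (hA.2.2.1 _ hw)

theorem mul_mem_emul {α β : Set ℝ*} (hα : IsExt α) (hβ : IsExt β) {x y : ℝ*} (hx : x ∈ α)
    (hy : y ∈ β) : x * y ∈ emul α β := by
  obtain ⟨A, hA, hαA⟩ := hα.eq_coset hx
  obtain ⟨B, hB, hβB⟩ := hβ.eq_coset hy
  exact ⟨x, A, y, B, hA, hB, hαA, hβB, 0, hA.1, 0, hB.1, 0, hA.1, 0, hB.1, by ring⟩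

theorem IsExt.emul {α β : Set ℝ*} (hα : IsExt α) (hβ : IsExt β) : IsExt (emul α β) := by
  obtain ⟨a, A, hA, rfl⟩ := hα
  obtain ⟨b, B, hB, rfl⟩ := hβ
  refine ⟨a * b, {z | ∃ u ∈ A, ∃ v ∈ B, ∃ u' ∈ A, ∃ v' ∈ B, z = a * v + b * u + u' * v'},
    isNeutrix_of_mul_mem ⟨0, hA.1, 0, hB.1, 0, hA.1, 0, hB.1, by ring⟩ ?_ ?_, ?_⟩
  · rintro _ ⟨u₁, hu₁, v₁, hv₁, u₁', hu₁', v₁', hv₁', rfl⟩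
      _ ⟨u₂, hu₂, v₂, hv₂, u₂', hu₂', v₂', hv₂', rfl⟩
    obtain ⟨u, hu, v, hv, h⟩ := hA.exists_mul_eq_add hB hu₁' hu₂' hv₁' hv₂'
    exact ⟨_, hA.2.1 _ hu₁ _ hu₂, _, hB.2.1 _ hv₁ _ hv₂, u, hu, v, hv, by
      linear_combination h⟩
  · rintro t _ ht ⟨u, hu, v, hv, u', hu', v', hv', rfl⟩
    exact ⟨_, hA.mul_mem hu ht, _, hB.mul_mem hv ht, _, hA.mul_mem hu' ht, v', hv', by ring⟩
  · ext z
    constructor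
    · rintro ⟨a', A', b', B', hA', hB', hαA, hβB, u, hu, v, hv, u', hu', v', hv', rfl⟩
      obtain ⟨u₀, hu₀, rfl⟩ : a' ∈ coset a A := hαA ▸ mem_coset_self hA' a'
      obtain ⟨v₀, hv₀, rfl⟩ : b' ∈ coset b B := hβB ▸ mem_coset_self hB' b'
      replace hu := coset_subset_of_eq hA hA' hαA hu
      replace hu' := coset_subset_of_eq hA hA' hαA hu'
      replace hv := coset_subset_of_eq hB hB' hβB hv
      replace hv' := coset_subset_of_eq hB hB' hβB hv'
      obtain ⟨u₁, hu₁, v₁, hv₁, h₁⟩ := hA.exists_mul_eq_add hB hu₀ hu (hB.2.1 _ hv₀ _ hv) hv₀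
      obtain ⟨u₂, hu₂, v₂, hv₂, h₂⟩ := hA.exists_mul_eq_add hB hu₁ hu' hv₁ hv'
      exact ⟨_, ⟨_, hA.2.1 _ hu₀ _ hu, _, hB.2.1 _ hv₀ _ hv, u₂, hu₂, v₂, hv₂, rfl⟩, by
        linear_combination h₁ + h₂⟩
    · rintro ⟨_, ⟨u, hu, v, hv, u', hu', v', hv', rfl⟩, rfl⟩
      exact ⟨a, A, b, B, hA, hB, rfl, rfl, u, hu, v, hv, u', hu', v', hv', by ring⟩

theorem isExt_eprod : ∀ {n : ℕ} {f : Fin n → Set ℝ*}, (∀ i, IsExt (f i)) → IsExt (eprod f)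
  | 0, _, _ => ⟨1, {0}, isNeutrix_of_mul_mem (by simp) (by simp) (by simp), by
      ext; simp [eprod, coset]⟩
  | _ + 1, _, hf => (hf 0).emul (isExt_eprod fun i => hf i.succ)

theorem prod_mem_eprod : ∀ {n : ℕ} {f : Fin n → Set ℝ*} {x : Fin n → ℝ*}, (∀ i, IsExt (f i)) →
    (∀ i, x i ∈ f i) → ∏ i, x i ∈ eprod f
  | 0, _, _, _, _ => by simp [eprod]
  | _ + 1, _, x, hf, hx => by
    rw [Fin.prod_univ_succ]
    exact mul_mem_emul (hf 0) (isExt_eprod fun i => hf i.succ) (hx 0)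
      (prod_mem_eprod (fun i => hf i.succ) fun i => hx i.succ)

theorem det_mem_detE {n : ℕ} {M : Matrix (Fin n) (Fin n) (Set ℝ*)}
    {a : Matrix (Fin n) (Fin n) ℝ*} (hM : ∀ i j, IsExt (M i j)) (ha : ∀ i j, a i j ∈ M i j) :
    a.det ∈ detE M := by
  rw [← Matrix.det_transpose, Matrix.det_apply']
  exact Set.finsetSum_mem_finsetSum _ _ _ fun σ _ =>
    ⟨_, prod_mem_eprod (fun i => hM i (σ i)) fun i => ha i (σ i), rfl⟩

theorem abs_lt_of_mem_oslash {x : ℝ*} (hx : x ∈ oslash) {c : ℝ} (hc : 0 < c) : |x| < c := by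
  have := hx c hc
  simpa [abs_lt] using this

theorem abs_lt_of_zeroless_coset {d v : ℝ*} {D : Set ℝ*} (hD : IsNeutrix D)
    (h : Zeroless (coset d D)) (hv : v ∈ D) : |v| < |d| := by
  by_contra! hle
  exact h ⟨-d, hD.mem_of_abs_le hv (by rwa [abs_neg]), by ring⟩

theorem abs_le_of_mem_emul_oslash {δ : Set ℝ*} (hδ : Zeroless δ) {d z : ℝ*} (hd : d ∈ δ)
    (hz : z ∈ emul oslash δ) {c : ℝ} (hc : 0 < c) : |z| ≤ c * |d| := by
  obtain ⟨a, A, e, D, hA, hD, haA, rfl, u, hu, v, hv, u', hu', v', hv', rfl⟩ := hz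
  have hsmall : ∀ w ∈ coset a A, |w| ≤ ((c / 9 : ℝ) : ℝ*) := fun w hw =>
    (abs_lt_of_mem_oslash (haA ▸ hw) (by positivity)).le
  have ha := hsmall a (mem_coset_self hA a)
  have hau := hsmall (a + u) ⟨u, hu, rfl⟩
  have hau' := hsmall (a + u') ⟨u', hu', rfl⟩
  have he : e ∈ coset d D := coset_eq_of_mem hD hd ▸ mem_coset_self hD e
  rw [coset_eq_of_mem hD hd] at hδ
  obtain ⟨w, hw, rfl⟩ := he
  have hw' := (abs_lt_of_zeroless_coset hD hδ hw).le
  have hv₁ := (abs_lt_of_zeroless_coset hD hδ hv).le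
  have hv₂ := (abs_lt_of_zeroless_coset hD hδ hv').le
  set k : ℝ* := ((c / 9 : ℝ) : ℝ*) with hk
  have hk9 : 9 * k = c := by rw [hk]; push_cast; ring
  have hk0 : 0 ≤ k := (abs_nonneg a).trans ha
  have he : |d + w| ≤ 2 * |d| := (abs_add_le d w).trans (by linarith)
  have hu₁ : |u| ≤ 2 * k := by
    calc |u| = |a + u - a| := by ring_nf
      _ ≤ |a + u| + |a| := abs_sub _ _
      _ ≤ 2 * k := by linarith
  have hu₂ : |u'| ≤ 2 * k := by
    calc |u'| = |a + u' - a| := by ring_nf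
      _ ≤ |a + u'| + |a| := abs_sub _ _
      _ ≤ 2 * k := by linarith
  calc |a * (d + w) + a * v + (d + w) * u + u' * v'|
      ≤ |a| * |d + w| + |a| * |v| + |d + w| * |u| + |u'| * |v'| := by
        simp only [← abs_mul]
        exact (abs_add_le _ _).trans (by gcongr; exact abs_add_three _ _ _)
    _ ≤ k * (2 * |d|) + k * |d| + 2 * |d| * (2 * k) + 2 * k * |d| := by gcongr
    _ = c * |d| := by rw [← hk9]; ring

theorem IsReducedMat.abs_le_two {m n : ℕ} {M : Matrix (Fin m) (Fin n) (Set ℝ*)}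
    (hM : IsReducedMat M) {i : Fin m} {j : Fin n} (hij : IsExt (M i j)) {x : ℝ*}
    (hx : x ∈ M i j) : |x| ≤ 2 := by
  obtain ⟨A₀, -, hA₀, -, hle⟩ := hM
  obtain ⟨A, hA, hMA⟩ := hij.eq_coset hx
  obtain ⟨_, ⟨w, hw, rfl⟩, hxw⟩ := hle i j |x| ⟨x, A, hA, hMA, 0, hA.1, by ring⟩
  have h : |w| < 1 := by simpa using abs_lt_of_mem_oslash (hA₀ hw) one_pos
  linarith [le_abs_self w]


theorem stmt10 {n : ℕ} (M : Matrix (Fin (n + 1)) (Fin (n + 1)) (Set ℝ*))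
    (hM : ∀ i j, IsExt (M i j)) (hred : IsReducedMat M) (hzl : Zeroless (detE M)) :
    ∀ j, ∃ i, ¬ minorE M i j ⊆ emul oslash (detE M) := by
  intro j
  by_contra! hmin
  have hne : ∀ i j, ∃ x, x ∈ M i j := fun i j => by
    obtain ⟨x, A, hA, h⟩ := hM i j
    exact ⟨x, h ▸ mem_coset_self hA x⟩
  choose a ha using hne
  have hdet : Matrix.det a ∈ detE M := det_mem_detE hM ha
  set c : ℝ := 1 / (4 * (n + 1)) with hc
  have hcpos : 0 < c := by positivity
  have hterm : ∀ i : Fin (n + 1), |(-1) ^ (i + j : ℕ) * a i j *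
      Matrix.det (Matrix.submatrix a i.succAbove j.succAbove)| ≤ 2 * (c * |Matrix.det a|) := by
    intro i
    have hmem : Matrix.det (Matrix.submatrix a i.succAbove j.succAbove) ∈ minorE M i j :=
      det_mem_detE (fun _ _ => hM _ _) fun _ _ => ha _ _
    have hsub := abs_le_of_mem_emul_oslash hzl hdet (hmin i hmem) hcpos
    have hent := hred.abs_le_two (hM i j) (ha i j)
    rw [abs_mul, abs_mul, abs_pow, abs_neg, abs_one, one_pow, one_mul]
    gcongr
  have hle : |Matrix.det a| ≤ (n + 1) * (2 * (c * |Matrix.det a|)) := by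
    conv_lhs => rw [Matrix.det_succ_column a j]
    refine (Finset.abs_sum_le_sum_abs _ _).trans ((Finset.sum_le_sum fun i _ => hterm i).trans ?_)
    simp
  have hcn : ((n : ℝ*) + 1) * (2 * c) = 1 / 2 := by
    have : ((n : ℝ) + 1) * (2 * c) = 1 / 2 := by rw [hc]; field_simp; norm_num
    have h := congrArg (fun r : ℝ => (r : ℝ*)) this
    have hn : ((n : ℝ) : ℝ*) = n := rfl
    push_cast at h
    rwa [hn] at h
  have hhalf : |Matrix.det a| ≤ 1 / 2 * |Matrix.det a| := by
    rw [← hcn]; linarith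
  have hzero : Matrix.det a = 0 := abs_nonpos_iff.mp (by linarith)
  exact hzl (hzero ▸ hdet)
end
end

section
/- Let A = (α_{ij}) = (a_{ij} + A_{ij}) be a non-singular n×n matrix over 𝔼 such that ᾱ = max_{i,j} |α_{ij}| is zeroless and the relative uncertainty R(A) = det(A)/ᾱⁿ is not an absorber of Ā (i.e. it is not the case that R(A)·Ā ⊊ Ā). Then A is invertible with respect to the neutrix Ā/ᾱ, and B = (1/det(A))·Cᵀ is an inverse matrix of A with respect to Ā/ᾱ, where C = ((−1)^{i+j} Δ_{i,j}) is the cofactor matrix of A; that is, AB ⊆ I_n(Ā/ᾱ) and BA ⊆ I_n(Ā/ᾱ). -/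
open scoped Pointwise Classical

noncomputable section

open ArchimedeanClass in
/-- The subring of limited hyperreals. -/
def limited : Subring ℝ* where
  carrier := {x | 0 ≤ mk x}
  mul_mem' {x y} hx hy := by
    simpa using add_nonneg (show 0 ≤ mk x from hx) (show 0 ≤ mk y from hy)
  one_mem' := by simp
  add_mem' {x y} hx hy :=
    show 0 ≤ mk (x + y) from le_trans (le_min (show 0 ≤ mk x from hx) (show 0 ≤ mk y from hy))
      (min_le_mk_add x y)
  zero_mem' := by simp
  neg_mem' {x} hx := by simpa using hx

theorem mem_limited_iff {x : ℝ*} : x ∈ limited ↔ ∃ k : ℕ, |x| ≤ k := by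
  change ArchimedeanClass.mk (1 : ℝ*) ≤ ArchimedeanClass.mk x ↔ _
  rw [ArchimedeanClass.mk_le_mk]
  simp

namespace IsNeutrix

variable {N : Set ℝ*}

theorem zero_mem (hN : IsNeutrix N) : (0 : ℝ*) ∈ N := hN.1

theorem add_mem (hN : IsNeutrix N) {x y : ℝ*} (hx : x ∈ N) (hy : y ∈ N) : x + y ∈ N :=
  hN.2.1 x hx y hy

theorem neg_mem (hN : IsNeutrix N) {x : ℝ*} (hx : x ∈ N) : -x ∈ N := hN.2.2.1 x hx

theorem sub_mem (hN : IsNeutrix N) {x y : ℝ*} (hx : x ∈ N) (hy : y ∈ N) : x - y ∈ N := by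
  rw [sub_eq_add_neg]
  exact hN.add_mem hx (hN.neg_mem hy)

theorem abs_mem (hN : IsNeutrix N) {x : ℝ*} (hx : x ∈ N) : |x| ∈ N := by
  rcases abs_choice x with h | h <;> rw [h]
  · exact hx
  · exact hN.neg_mem hx

theorem mem_of_abs_le_s14 (hN : IsNeutrix N) {x y : ℝ*} (hx : x ∈ N) (h : |y| ≤ |x|) : y ∈ N :=
  hN.2.2.2 _ (hN.neg_mem (hN.abs_mem hx)) _ (hN.abs_mem hx) _ (abs_le.1 h).1 (abs_le.1 h).2

theorem natCast_mul_mem (hN : IsNeutrix N) (k : ℕ) {x : ℝ*} (hx : x ∈ N) :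
    (k : ℝ*) * x ∈ N := by
  induction k with
  | zero => simpa using hN.zero_mem
  | succ k ih =>
    rw [Nat.cast_succ, add_mul, one_mul]
    exact hN.add_mem ih hx

theorem mul_mem_of_limited (hN : IsNeutrix N) {t x : ℝ*} (ht : t ∈ limited) (hx : x ∈ N) :
    t * x ∈ N := by
  obtain ⟨k, hk⟩ := mem_limited_iff.1 ht
  refine hN.mem_of_abs_le_s14 (hN.natCast_mul_mem k hx) ?_
  rw [abs_mul, abs_mul, Nat.abs_cast]
  exact mul_le_mul_of_nonneg_right hk (abs_nonneg x)

/-- Scalar multiples of neutrices are neutrices. -/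
theorem isNeutrix_esmul (hN : IsNeutrix N) (t : ℝ*) : IsNeutrix (esmul t N) := by
  rcases eq_or_ne t 0 with rfl | ht
  · have h : esmul 0 N = {0} := by
      ext z
      constructor
      · rintro ⟨w, -, rfl⟩
        simp
      · rintro rfl
        exact ⟨0, hN.zero_mem, by simp⟩
    rw [h]
    refine ⟨rfl, ?_, ?_, ?_⟩
    · rintro x rfl y rfl
      simp
    · rintro x rfl
      simp
    · rintro x rfl y rfl z h1 h2
      exact le_antisymm h2 h1
  · have key : ∀ z, z ∈ esmul t N ↔ z / t ∈ N := by
      intro z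
      constructor
      · rintro ⟨w, hw, rfl⟩
        simpa [ht] using hw
      · intro h
        exact ⟨z / t, h, by field_simp⟩
    refine ⟨(key 0).2 (by simpa using hN.zero_mem), ?_, ?_, ?_⟩
    · intro x hx y hy
      rw [key] at *
      rw [add_div]
      exact hN.add_mem hx hy
    · intro x hx
      rw [key] at *
      rw [neg_div]
      exact hN.neg_mem hx
    · intro x hx y hy z h1 h2
      rw [key] at *
      rcases lt_or_gt_of_ne ht with h | h
      · exact hN.2.2.2 _ hy _ hx _ (div_le_div_of_nonpos_of_le h.le h2)
          (div_le_div_of_nonpos_of_le h.le h1)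
      · exact hN.2.2.2 _ hx _ hy _ (by gcongr) (by gcongr)

theorem natCast_mul_abs_lt (hN : IsNeutrix N) {c : ℝ*} (hc : c ∉ N) (k : ℕ) {x : ℝ*} (hx : x ∈ N) :
    k * |x| < |c| := by
  by_contra! h
  refine hc (hN.mem_of_abs_le_s14 (hN.natCast_mul_mem k hx) ?_)
  rwa [abs_mul, Nat.abs_cast]

theorem abs_lt_one (hN : IsNeutrix N) (h1 : (1 : ℝ*) ∉ N) {x : ℝ*} (hx : x ∈ N) : |x| < 1 := by
  simpa using hN.natCast_mul_abs_lt h1 1 hx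

theorem mem_limited (hN : IsNeutrix N) (h1 : (1 : ℝ*) ∉ N) {x : ℝ*} (hx : x ∈ N) :
    x ∈ limited :=
  mem_limited_iff.2 ⟨1, by simpa using (hN.abs_lt_one h1 hx).le⟩

theorem half_lt_abs_one_add (hN : IsNeutrix N) (h1 : (1 : ℝ*) ∉ N) {x : ℝ*} (hx : x ∈ N) :
    1 / 2 < |1 + x| := by
  have h := hN.natCast_mul_abs_lt h1 2 hx
  rw [abs_one] at h
  push_cast at h
  have := neg_abs_le x
  refine lt_of_lt_of_le ?_ (le_abs_self _)
  linarith

theorem inv_one_add_limited (hN : IsNeutrix N) (h1 : (1 : ℝ*) ∉ N) {x : ℝ*} (hx : x ∈ N) :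
    (1 + x)⁻¹ ∈ limited := by
  have h := hN.half_lt_abs_one_add h1 hx
  refine mem_limited_iff.2 ⟨2, ?_⟩
  rw [abs_inv, inv_le_comm₀ (by linarith) (by norm_num)]
  push_cast
  linarith

end IsNeutrix

/-- The neutrix of infinitesimals, described by archimedean classes. -/
def infinitesimals : Set ℝ* := {x | 0 < ArchimedeanClass.mk x}

theorem isNeutrix_infinitesimals : IsNeutrix infinitesimals := by
  have key : ∀ x, x ∈ infinitesimals ↔ ∀ k : ℕ, k * |x| < 1 := by
    intro x
    change ArchimedeanClass.mk (1 : ℝ*) < ArchimedeanClass.mk x ↔ _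
    rw [ArchimedeanClass.mk_lt_mk]
    simp
  refine ⟨by simp [infinitesimals], ?_, ?_, ?_⟩
  · intro x hx y hy
    exact lt_of_lt_of_le (lt_min (show 0 < ArchimedeanClass.mk x from hx)
      (show 0 < ArchimedeanClass.mk y from hy)) (ArchimedeanClass.min_le_mk_add x y)
  · intro x hx
    simpa [infinitesimals] using hx
  · intro x hx y hy z h1 h2
    rw [key] at *
    intro k
    have hz : |z| ≤ max |x| |y| := abs_le_max_abs_abs h1 h2
    rcases le_max_iff.1 hz with h | h
    · exact lt_of_le_of_lt (by gcongr) (hx k)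
    · exact lt_of_le_of_lt (by gcongr) (hy k)

theorem one_notMem_infinitesimals : (1 : ℝ*) ∉ infinitesimals := by
  simp [infinitesimals]

theorem IsNeutrix.subset_infinitesimals {N : Set ℝ*} (hN : IsNeutrix N) (h1 : (1 : ℝ*) ∉ N) :
    N ⊆ infinitesimals := by
  intro x hx
  change ArchimedeanClass.mk (1 : ℝ*) < ArchimedeanClass.mk x
  rw [ArchimedeanClass.mk_lt_mk]
  intro k
  simpa using hN.natCast_mul_abs_lt h1 k hx

section coset

variable {a b : ℝ*} {A B : Set ℝ*}

theorem IsNeutrix.self_mem_coset (hA : IsNeutrix A) (a : ℝ*) : a ∈ coset a A :=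
  ⟨0, hA.zero_mem, by simp⟩

theorem IsNeutrix.Nx_coset (hA : IsNeutrix A) (a : ℝ*) : Nx (coset a A) = A := by
  ext d
  constructor
  · rintro ⟨_, ⟨u, hu, rfl⟩, _, ⟨v, hv, rfl⟩, rfl⟩
    rw [add_sub_add_left_eq_sub]
    exact hA.sub_mem hu hv
  · intro hd
    exact ⟨a + d, ⟨d, hd, rfl⟩, a, hA.self_mem_coset a, by ring⟩

theorem IsNeutrix.coset_inj (hA : IsNeutrix A) (hB : IsNeutrix B) (h : coset a A = coset b B) :
    A = B ∧ ∃ e ∈ A, b = a + e := by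
  refine ⟨?_, ?_⟩
  · rw [← hA.Nx_coset a, h, hB.Nx_coset]
  · have hb := hB.self_mem_coset b
    rw [← h] at hb
    exact hb

theorem IsNeutrix.eabs_coset (hA : IsNeutrix A) (a : ℝ*) : eabs (coset a A) = coset |a| A := by
  ext z
  constructor
  · rintro ⟨b, B, hB, h, u, hu, rfl⟩
    obtain ⟨rfl, e, he, rfl⟩ := hA.coset_inj hB h
    refine ⟨|a + e| - |a| + u, hA.add_mem (hA.mem_of_abs_le_s14 he ?_) hu, by ring⟩
    simpa using abs_abs_sub_abs_le (a + e) a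
  · rintro ⟨u, hu, rfl⟩
    exact ⟨a, A, hA, rfl, u, hu, rfl⟩

end coset

/-- `α` lies in the coset `x + sN`, and `x / s` is limited: the external number `α` is
approximated by `x` with precision `N` at scale `s`. -/
def Approx (N : Set ℝ*) (s x : ℝ*) (α : Set ℝ*) : Prop :=
  (∃ y ∈ limited, x = s * y) ∧ ∀ z ∈ α, ∃ w ∈ N, z = x + s * w

namespace Approx

variable {N α β : Set ℝ*} {s t x y : ℝ*}

theorem emul (hN : IsNeutrix N) (h1 : (1 : ℝ*) ∉ N) (hα : Approx N s x α) (hβ : Approx N t y β) :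
    Approx N (s * t) (x * y) (emul α β) := by
  obtain ⟨⟨x, hx, rfl⟩, hα⟩ := hα
  obtain ⟨⟨y, hy, rfl⟩, hβ⟩ := hβ
  refine ⟨⟨x * y, mul_mem hx hy, by ring⟩, ?_⟩
  rintro z ⟨a, A, b, B, hA, hB, rfl, rfl, u, hu, v, hv, u', hu', v', hv', rfl⟩
  obtain ⟨e, he, h_a⟩ := hα a (hA.self_mem_coset a)
  obtain ⟨f, hf, h_b⟩ := hβ b (hB.self_mem_coset b)
  obtain ⟨e₂, he₂, h_u⟩ := hα (a + u) ⟨u, hu, rfl⟩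
  obtain ⟨f₂, hf₂, h_v⟩ := hβ (b + v) ⟨v, hv, rfl⟩
  obtain ⟨e₃, he₃, h_u'⟩ := hα (a + u') ⟨u', hu', rfl⟩
  obtain ⟨f₃, hf₃, h_v'⟩ := hβ (b + v') ⟨v', hv', rfl⟩
  have lim {w : ℝ*} (hw : w ∈ N) : w ∈ limited := hN.mem_limited h1 hw
  refine ⟨(x + e) * f₂ + y * e + (y + f) * (e₂ - e) + (e₃ - e) * (f₃ - f), ?_, ?_⟩
  · exact hN.add_mem (hN.add_mem (hN.add_mem
      (hN.mul_mem_of_limited (add_mem hx (lim he)) hf₂) (hN.mul_mem_of_limited hy he))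
      (hN.mul_mem_of_limited (add_mem hy (lim hf)) (hN.sub_mem he₂ he)))
      (hN.mul_mem_of_limited (sub_mem (lim he₃) (lim he)) (hN.sub_mem hf₃ hf))
  · obtain rfl : u = s * (e₂ - e) := by linear_combination h_u - h_a
    obtain rfl : v = t * (f₂ - f) := by linear_combination h_v - h_b
    obtain rfl : u' = s * (e₃ - e) := by linear_combination h_u' - h_a
    obtain rfl : v' = t * (f₃ - f) := by linear_combination h_v' - h_b
    rw [h_a, h_b]
    ring

theorem add (hN : IsNeutrix N) (hα : Approx N s x α) (hβ : Approx N s y β) :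
    Approx N s (x + y) (α + β) := by
  obtain ⟨⟨x, hx, rfl⟩, hα⟩ := hα
  obtain ⟨⟨y, hy, rfl⟩, hβ⟩ := hβ
  refine ⟨⟨x + y, add_mem hx hy, by ring⟩, ?_⟩
  rintro _ ⟨a, ha, b, hb, rfl⟩
  obtain ⟨e, he, rfl⟩ := hα a ha
  obtain ⟨f, hf, rfl⟩ := hβ b hb
  exact ⟨e + f, hN.add_mem he hf, by ring⟩

theorem sum (hN : IsNeutrix N) {ι : Type*} (S : Finset ι) {ξ : ι → ℝ*} {α : ι → Set ℝ*}
    (h : ∀ i ∈ S, Approx N s (ξ i) (α i)) : Approx N s (∑ i ∈ S, ξ i) (∑ i ∈ S, α i) := by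
  induction S using Finset.induction_on with
  | empty =>
    refine ⟨⟨0, zero_mem _, by simp⟩, ?_⟩
    intro z hz
    exact ⟨0, hN.zero_mem, by simpa using hz⟩
  | insert i S hi ih =>
    rw [Finset.sum_insert hi, Finset.sum_insert hi]
    exact (h i (Finset.mem_insert_self i S)).add hN
      (ih fun j hj => h j (Finset.mem_insert_of_mem hj))

theorem esmul (hN : IsNeutrix N) (ht : t ∈ limited) (hα : Approx N s x α) :
    Approx N s (t * x) (esmul t α) := by
  obtain ⟨⟨x, hx, rfl⟩, hα⟩ := hα
  refine ⟨⟨t * x, mul_mem ht hx, by ring⟩, ?_⟩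
  rintro _ ⟨a, ha, rfl⟩
  obtain ⟨e, he, rfl⟩ := hα a ha
  exact ⟨t * e, hN.mul_mem_of_limited ht he, by ring⟩

theorem singleton_one (hN : IsNeutrix N) : Approx N 1 1 {1} := by
  refine ⟨⟨1, one_mem _, by simp⟩, ?_⟩
  rintro _ rfl
  exact ⟨0, hN.zero_mem, by simp⟩

theorem eprod (hN : IsNeutrix N) (h1 : (1 : ℝ*) ∉ N) {k : ℕ} {ξ : Fin k → ℝ*}
    {α : Fin k → Set ℝ*} (h : ∀ i, Approx N s (ξ i) (α i)) :
    Approx N (s ^ k) (∏ i, ξ i) (eprod α) := by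
  induction k with
  | zero => simpa [_root_.eprod] using singleton_one hN
  | succ k ih =>
    rw [Fin.prod_univ_succ, pow_succ', _root_.eprod]
    exact (h 0).emul hN h1 (ih fun i => h i.succ)

theorem epow (hN : IsNeutrix N) (h1 : (1 : ℝ*) ∉ N) (h : Approx N s x α) (k : ℕ) :
    Approx N (s ^ k) (x ^ k) (epow α k) := by
  induction k with
  | zero => simpa [_root_.epow] using singleton_one hN
  | succ k ih =>
    rw [pow_succ', pow_succ', _root_.epow]
    exact h.emul hN h1 ih

theorem detE (hN : IsNeutrix N) (h1 : (1 : ℝ*) ∉ N) {k : ℕ} {a : Matrix (Fin k) (Fin k) ℝ*}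
    {M : Matrix (Fin k) (Fin k) (Set ℝ*)} (h : ∀ i j, Approx N s (a i j) (M i j)) :
    Approx N (s ^ k) a.det (detE M) := by
  rw [← Matrix.det_transpose, Matrix.det_apply', _root_.detE]
  refine sum hN _ fun σ _ => ?_
  refine esmul hN ?_ (eprod hN h1 fun i => ?_)
  · exact intCast_mem _ _
  · simpa using h i (σ i)

theorem einv (hN : IsNeutrix N) (h1 : (1 : ℝ*) ∉ N) (hx : x ≠ 0) (h : Approx N x x α) :
    Approx N x⁻¹ x⁻¹ (einv α) := by
  refine ⟨⟨1, one_mem _, by simp⟩, ?_⟩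
  rintro z ⟨a, A, hA, rfl, u, hu, rfl⟩
  obtain ⟨e, he, h_a⟩ := h.2 a (hA.self_mem_coset a)
  obtain ⟨e₂, he₂, h_u⟩ := h.2 (a + u) ⟨u, hu, rfl⟩
  obtain rfl : u = x * (e₂ - e) := by linear_combination h_u - h_a
  have hl := hN.inv_one_add_limited h1 he
  have hne : 1 + e ≠ 0 := by
    intro h0
    have := hN.half_lt_abs_one_add h1 he
    rw [h0, abs_zero] at this
    linarith
  obtain rfl : a = x * (1 + e) := by linear_combination h_a
  refine ⟨(1 + e)⁻¹ * (-e) + ((1 + e)⁻¹ * (1 + e)⁻¹) * (e₂ - e), ?_, ?_⟩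
  · exact hN.add_mem (hN.mul_mem_of_limited hl (hN.neg_mem he))
      (hN.mul_mem_of_limited (mul_mem hl hl) (hN.sub_mem he₂ he))
  · field_simp
    ring

theorem self_of_coset {a : ℝ*} {A : Set ℝ*} (hA : IsNeutrix A) (ha : a ∉ A) :
    Approx infinitesimals a a (coset a A) := by
  have ha0 : a ≠ 0 := by
    rintro rfl
    exact ha hA.zero_mem
  refine ⟨⟨1, one_mem _, by simp⟩, ?_⟩
  rintro _ ⟨u, hu, rfl⟩
  refine ⟨a⁻¹ * u, (hA.isNeutrix_esmul a⁻¹).subset_infinitesimals ?_ ⟨u, hu, rfl⟩, by field_simp⟩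
  rintro ⟨w, hw, hw1⟩
  apply ha
  have : a = w := by
    simp only at hw1
    field_simp at hw1
    exact hw1.symm
  rwa [this]

end Approx

/-- Zerolessness of a coset is the statement that its representative avoids the neutrix. -/
theorem IsNeutrix.zeroless_coset_iff {a : ℝ*} {A : Set ℝ*} (hA : IsNeutrix A) :
    Zeroless (coset a A) ↔ a ∉ A := by
  refine not_congr ⟨?_, fun h => ⟨-a, hA.neg_mem h, by simp⟩⟩
  rintro ⟨u, hu, h⟩
  obtain rfl : a = -u := by linear_combination -h
  exact hA.neg_mem hu

theorem IsNeutrix.einv_coset {a : ℝ*} {A : Set ℝ*} (hA : IsNeutrix A) (ha : a ∉ A) :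
    einv (coset a A) = coset a⁻¹ (esmul (a ^ 2)⁻¹ A) := by
  have ha0 : a ≠ 0 := by
    rintro rfl
    exact ha hA.zero_mem
  have hN := hA.isNeutrix_esmul a⁻¹
  have h1 : (1 : ℝ*) ∉ esmul a⁻¹ A := by
    rintro ⟨w, hw, hw1⟩
    simp only at hw1
    field_simp at hw1
    exact ha (hw1 ▸ hw)
  have happ : Approx (esmul a⁻¹ A) a a (coset a A) := by
    refine ⟨⟨1, one_mem _, by simp⟩, ?_⟩
    rintro _ ⟨u, hu, rfl⟩
    exact ⟨a⁻¹ * u, ⟨u, hu, rfl⟩, by field_simp⟩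
  ext z
  constructor
  · intro hz
    obtain ⟨_, ⟨u, hu, rfl⟩, rfl⟩ := (happ.einv hN h1 ha0).2 z hz
    exact ⟨(a ^ 2)⁻¹ * u, ⟨u, hu, rfl⟩, by field_simp⟩
  · rintro ⟨_, ⟨u, hu, rfl⟩, rfl⟩
    exact ⟨a, A, hA, rfl, u, hu, by simp only; field_simp⟩

theorem coset_zero (A : Set ℝ*) : coset 0 A = A := by
  ext z
  simp [coset]

/-- If the product of `ρ` with a neutrix is not strictly smaller than that neutrix, and `ρ` is
a limited number `r` up to a relatively infinitesimal error, then `r` does not shrink the neutrix. -/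
theorem IsNeutrix.subset_esmul_of_not_absorber {N ρ : Set ℝ*} {r : ℝ*} (hN : IsNeutrix N)
    (hr : r ∈ limited) (hρ : ∀ z ∈ ρ, ∃ w ∈ infinitesimals, z = r + r * w)
    (h : ¬ emul ρ N ⊂ N) : N ⊆ esmul r N := by
  by_contra hsub
  have hle : emul ρ N ⊆ esmul r N := by
    rintro z ⟨a, A, b, B, hA, hB, rfl, hb, u, hu, v, hv, u', hu', v', hv', rfl⟩
    rw [← coset_zero N] at hb
    obtain ⟨rfl, e, he, rfl⟩ := hN.coset_inj hB hb
    obtain ⟨w, hw, h_a⟩ := hρ a (hA.self_mem_coset a)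
    obtain ⟨w₂, hw₂, h_u⟩ := hρ (a + u) ⟨u, hu, rfl⟩
    obtain ⟨w₃, hw₃, h_u'⟩ := hρ (a + u') ⟨u', hu', rfl⟩
    obtain rfl : u = r * (w₂ - w) := by linear_combination h_u - h_a
    obtain rfl : u' = r * (w₃ - w) := by linear_combination h_u' - h_a
    have lim {x : ℝ*} (hx : x ∈ infinitesimals) : x ∈ limited :=
      isNeutrix_infinitesimals.mem_limited one_notMem_infinitesimals hx
    refine ⟨(1 + w) * e + (1 + w) * v + (w₂ - w) * e + (w₃ - w) * v', ?_, ?_⟩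
    · exact hN.add_mem (hN.add_mem (hN.add_mem
        (hN.mul_mem_of_limited (AddMemClass.add_mem (one_mem _) (lim hw)) he)
        (hN.mul_mem_of_limited (AddMemClass.add_mem (one_mem _) (lim hw)) hv))
        (hN.mul_mem_of_limited (_root_.sub_mem (lim hw₂) (lim hw)) he))
        (hN.mul_mem_of_limited (_root_.sub_mem (lim hw₃) (lim hw)) hv')
    · rw [h_a]
      ring
  refine h ⟨hle.trans ?_, fun h' => hsub (h'.trans hle)⟩
  rintro _ ⟨w, hw, rfl⟩
  exact hN.mul_mem_of_limited hr hw


theorem IsNeutrix.esmul_inv_subset_ediv {K A : Set ℝ*} {c : ℝ*} (hK : IsNeutrix K)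
    (hA : IsNeutrix A) (hc : c ∉ A) : esmul c⁻¹ K ⊆ ediv K (coset c A) := by
  rintro _ ⟨w, hw, rfl⟩
  have hB := hA.isNeutrix_esmul (c ^ 2)⁻¹
  exact ⟨0, K, c⁻¹, _, hK, hB, (coset_zero K).symm, hA.einv_coset hc, w, hw, 0, hB.zero_mem,
    0, hK.zero_mem, 0, hB.zero_mem, by simp only; ring⟩

/-- An approximation of an entry of the identity matrix at scale `t` lies in the near-identity
matrix for every set containing `tN`. -/
theorem Approx.subset_Iun {N P α : Set ℝ*} {t x : ℝ*} {k : ℕ} {i j : Fin k}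
    (h : Approx N t x α) (hx : x = (1 : Matrix (Fin k) (Fin k) ℝ*) i j) (hP : _root_.esmul t N ⊆ P) :
    α ⊆ Iun k P i j := by
  intro z hz
  obtain ⟨w, hw, rfl⟩ := h.2 z hz
  have hw' : t * w ∈ P := hP ⟨w, hw, rfl⟩
  by_cases hij : i = j
  · rw [Matrix.one_apply, if_pos hij] at hx
    rw [Iun, if_pos hij]
    exact ⟨t * w, hw', by rw [hx]⟩
  · rw [Matrix.one_apply, if_neg hij] at hx
    rw [Iun, if_neg hij, hx, zero_add]
    exact hw'

theorem stmt14 {n : ℕ} (M : Matrix (Fin (n + 1)) (Fin (n + 1)) (Set ℝ*))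
    (hM : ∀ i j, IsExt (M i j)) (hns : Zeroless (detE M))
    (abar Abar : Set ℝ*)
    (habar1 : ∃ i j, abar = eabs (M i j)) (habar2 : ∀ i j, ele (eabs (M i j)) abar)
    (hzl : Zeroless abar)
    (hAbar1 : ∃ i j, Abar = Nx (M i j)) (hAbar2 : ∀ i j, Nx (M i j) ⊆ Abar)
    (habsorb : ¬ emul (ediv (detE M) (epow abar (n + 1))) Abar ⊂ Abar) :
    matIncl
        (matMul M (fun i j =>
          emul (einv (detE M)) (esmul ((-1 : ℝ*) ^ ((j : ℕ) + (i : ℕ))) (minorE M j i))))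
        (Iun (n + 1) (ediv Abar abar)) ∧
      matIncl
        (matMul (fun i j =>
          emul (einv (detE M)) (esmul ((-1 : ℝ*) ^ ((j : ℕ) + (i : ℕ))) (minorE M j i))) M)
        (Iun (n + 1) (ediv Abar abar)) := by
  obtain ⟨a, A, hA, hMA⟩ : ∃ (a : Matrix (Fin (n + 1)) (Fin (n + 1)) ℝ*)
      (A : Fin (n + 1) → Fin (n + 1) → Set ℝ*),
      (∀ i j, IsNeutrix (A i j)) ∧ ∀ i j, M i j = coset (a i j) (A i j) := by
    choose a A hA hMA using hM
    exact ⟨a, A, hA, hMA⟩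
  obtain ⟨p, q, rfl⟩ := habar1
  obtain ⟨r, s, rfl⟩ := hAbar1
  have habs : ∀ i j, eabs (M i j) = coset |a i j| (A i j) := fun i j => by
    rw [hMA, (hA i j).eabs_coset]
  have hNx : ∀ i j, Nx (M i j) = A i j := fun i j => by
    rw [hMA, (hA i j).Nx_coset]
  simp only [habs] at habar2 hzl habsorb ⊢
  simp only [hNx] at hAbar2 habsorb ⊢
  generalize hc : |a p q| = c at *
  have hcA : c ∉ A p q := (hA p q).zeroless_coset_iff.1 hzl
  have hc0 : 0 < c := by
    refine lt_of_le_of_ne (hc ▸ abs_nonneg _) ?_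
    rintro rfl
    exact hcA (hA p q).zero_mem
  have hlt : ∀ y ∈ coset c (A p q), y < 2 * c := by
    rintro _ ⟨u, hu, rfl⟩
    have := (hA p q).natCast_mul_abs_lt hcA 1 hu
    rw [abs_of_pos hc0, Nat.cast_one, one_mul] at this
    linarith [le_abs_self u]
  have hbound : ∀ i j, ∀ u ∈ A i j, |a i j| + u < 2 * c := fun i j u hu => by
    obtain ⟨y, hy, hle⟩ := habar2 i j _ ⟨u, hu, rfl⟩
    exact lt_of_le_of_lt hle (hlt y hy)
  have hK := hA r s
  have hcK : c ∉ A r s := fun h => by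
    have := hbound r s _ (hK.add_mem h h)
    linarith [abs_nonneg (a r s)]
  set N := esmul c⁻¹ (A r s)
  have hN : IsNeutrix N := hK.isNeutrix_esmul _
  have h1 : (1 : ℝ*) ∉ N := by
    rintro ⟨w, hw, hw1⟩
    simp only at hw1
    field_simp at hw1
    exact hcK (hw1 ▸ hw)
  have hent : ∀ i j, Approx N c (a i j) (M i j) := fun i j => by
    refine ⟨⟨a i j / c, mem_limited_iff.2 ⟨2, ?_⟩, by field_simp⟩, ?_⟩
    · rw [abs_div, abs_of_pos hc0, div_le_iff₀ hc0]
      simpa using (hbound i j 0 (hA i j).zero_mem).le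
    · rw [hMA]
      rintro _ ⟨u, hu, rfl⟩
      exact ⟨c⁻¹ * u, ⟨u, hAbar2 i j hu, rfl⟩, by field_simp⟩
  have hdet := Approx.detE hN h1 hent
  have hcn : c ^ (n + 1) ≠ 0 := by positivity
  obtain ⟨d₀, D, hD, hDeq⟩ : IsExt (detE M) := by
    by_contra hne
    have hempty : emul (ediv (detE M) (epow (coset c (A p q)) (n + 1))) (A r s) = ∅ := by
      rw [Set.eq_empty_iff_forall_notMem]
      rintro z ⟨b, B, -, -, hB, -, hb, -⟩
      have hmem := hB.self_mem_coset b
      rw [← hb] at hmem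
      obtain ⟨d₀, D, -, -, hD, -, hDeq, -⟩ := hmem
      exact hne ⟨d₀, D, hD, hDeq⟩
    rw [hempty] at habsorb
    exact habsorb ((Set.empty_ssubset).2 ⟨0, hK.zero_mem⟩)
  have hd₀D : d₀ ∉ D := hD.zeroless_coset_iff.1 (hDeq ▸ hns)
  have hd₀ : d₀ ≠ 0 := by
    rintro rfl
    exact hd₀D hD.zero_mem
  have hmem₀ : d₀ ∈ detE M := hDeq ▸ hD.self_mem_coset d₀
  obtain ⟨w₀, hw₀, hdw₀⟩ := hdet.2 d₀ hmem₀
  set d := a.det with hd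
  have hKr : A r s ⊆ esmul (d₀ * (c ^ (n + 1))⁻¹) (A r s) := by
    refine hK.subset_esmul_of_not_absorber ?_ ?_ habsorb
    · obtain ⟨y, hy, hdy⟩ := hdet.1
      have : d₀ * (c ^ (n + 1))⁻¹ = y + w₀ := by
        rw [hdw₀, hdy]
        field_simp
      rw [this]
      exact add_mem hy (hN.mem_limited h1 hw₀)
    · have hO := isNeutrix_infinitesimals
      have hO1 := one_notMem_infinitesimals
      have hpow := ((Approx.self_of_coset (hA p q) hcA).epow hO hO1 (n + 1)).einv hO hO1 hcn
      have hdO := Approx.self_of_coset hD hd₀D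
      rw [← hDeq] at hdO
      exact (hdO.emul hO hO1 hpow).2
  have hNr : ∀ w ∈ N, ∃ w' ∈ N, c ^ (n + 1) * w = d₀ * w' := by
    rintro _ ⟨u, hu, rfl⟩
    obtain ⟨v, hv, rfl⟩ := hKr hu
    refine ⟨c⁻¹ * v, ⟨v, hv, rfl⟩, ?_⟩
    simp only
    field_simp
  obtain ⟨e, he, hde⟩ := hNr w₀ hw₀
  have hdd₀ : d = d₀ * (1 + -e) := by linear_combination -hdw₀ - hde
  have hinv := hN.inv_one_add_limited h1 (hN.neg_mem he)
  have hne : 1 + -e ≠ 0 := by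
    intro h0
    have := hN.half_lt_abs_one_add h1 (hN.neg_mem he)
    rw [h0, abs_zero] at this
    linarith
  have hd0 : d ≠ 0 := hdd₀ ▸ mul_ne_zero hd₀ hne
  have hNd : ∀ w ∈ N, ∃ w' ∈ N, c ^ (n + 1) * w = d * w' := fun w hw => by
    obtain ⟨w', hw', h⟩ := hNr w hw
    refine ⟨(1 + -e)⁻¹ * w', hN.mul_mem_of_limited hinv hw', ?_⟩
    rw [h, hdd₀]
    field_simp
  have hdetd : Approx N d d (detE M) := by
    refine ⟨⟨1, one_mem _, by simp⟩, fun z hz => ?_⟩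
    obtain ⟨w, hw, rfl⟩ := hdet.2 z hz
    obtain ⟨w', hw', h⟩ := hNd w hw
    exact ⟨w', hw', by rw [h]⟩
  have hB : ∀ i j, Approx N (d⁻¹ * c ^ n) (d⁻¹ * a.adjugate i j)
      (emul (einv (detE M)) (esmul ((-1 : ℝ*) ^ ((j : ℕ) + (i : ℕ))) (minorE M j i))) := by
    intro i j
    rw [Matrix.adjugate_fin_succ_eq_det_submatrix]
    refine (hdetd.einv hN h1 hd0).emul hN h1 (Approx.esmul hN ?_ (Approx.detE hN h1 ?_))
    · exact pow_mem (neg_mem (one_mem _)) _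
    · exact fun k l => hent _ _
  have hsub : ∀ t, t * d = c ^ (n + 1) → esmul t N ⊆ ediv (A r s) (coset c (A p q)) := by
    intro t ht
    refine subset_trans ?_ (hK.esmul_inv_subset_ediv (hA p q) hcA)
    rintro _ ⟨w, hw, rfl⟩
    obtain ⟨w', hw', h⟩ := hNd w hw
    have : t * w = w' := by
      apply mul_left_cancel₀ hd0
      linear_combination h + w * ht
    simpa only [this] using hw'
  constructor <;> intro i j
  · refine Approx.subset_Iun (t := c * (d⁻¹ * c ^ n))
      (Approx.sum hN _ fun k _ => (hent i k).emul hN h1 (hB k j)) ?_ (hsub _ ?_)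
    · calc ∑ k, a i k * (d⁻¹ * a.adjugate k j) = d⁻¹ * (a * a.adjugate) i j := by
            rw [Matrix.mul_apply, Finset.mul_sum]
            exact Finset.sum_congr rfl fun k _ => by ring
        _ = _ := by
            rw [Matrix.mul_adjugate, Matrix.smul_apply, smul_eq_mul, ← hd, inv_mul_cancel_left₀ hd0]
    · field_simp
      ring
  · refine Approx.subset_Iun (t := d⁻¹ * c ^ n * c)
      (Approx.sum hN _ fun k _ => (hB i k).emul hN h1 (hent k j)) ?_ (hsub _ ?_)
    · calc ∑ k, d⁻¹ * a.adjugate i k * a k j = d⁻¹ * (a.adjugate * a) i j := by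
            rw [Matrix.mul_apply, Finset.mul_sum]
            exact Finset.sum_congr rfl fun k _ => by ring
        _ = _ := by
            rw [Matrix.adjugate_mul, Matrix.smul_apply, smul_eq_mul, ← hd, inv_mul_cancel_left₀ hd0]
    · field_simp
      ring
end
end
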